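/- arXiv:2003.09850 — 5 statements merged into one kernel-verified Lean document; each statement's English description precedes it below -/
import Mathlib

section
/- Let G = G₁ × G₂ × ⋯ × G_r be a finite abelian group, where for each 1 ≤ i ≤ r, G_i ≅ Z_{p_i^{i₁}} × Z_{p_i^{i₂}} × ⋯ × Z_{p_i^{i_{n_i}}} is the Sylow p_i-subgroup of G (of rank n_i), and p₁, …, p_r are distinct primes. Let x ∈ G have order o(x) = (∏_{i=1}^{k} p_{α_i}) · (∏_{i=1}^{l} p_{β_i}^{γ_i}), where the indices α₁, …, α_k, β₁, …, β_l are pairwise distinct elements of {1, …, r}, each γ_i ≥ 2, and either k + l ≥ 2 or l ≥ 1. Then the degree of x in the co-prime order graph Θ(G) equals (1 − k − l + ∑_{j=1}^{k} |G_{α_j}| + ∑_{j=1}^{l} p_{β_j}^{n_{β_j}}) · |G| / ((∏_{i=1}^{k} |G_{α_i}|)(∏_{i=1}^{l} |G_{β_i}|)). -/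
/-- The co-prime order graph `Θ(G)` of a group `G`: vertices are elements of `G`,
and two distinct vertices `x, y` are adjacent iff `gcd(o(x), o(y))` is `1` or a prime. -/
def coprimeOrderGraph (G : Type*) [Group G] : SimpleGraph G where
  Adj x y := x ≠ y ∧ ((orderOf x).gcd (orderOf y) = 1 ∨ ((orderOf x).gcd (orderOf y)).Prime)
  symm := by
    constructor
    intro x y h
    exact ⟨h.1.symm, by rw [Nat.gcd_comm]; exact h.2⟩
  loopless := by
    constructor
    intro x h
    exact h.1 rfl

/-- The degree of a vertex in the co-prime order graph. -/
noncomputable def cpoDeg {G : Type*} [Group G] (x : G) : ℕ :=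
  Nat.card ((coprimeOrderGraph G).neighborSet x)

/-- The Sylow `p`-factor `Z_{p^{e 1}} × ⋯ × Z_{p^{e n}}`, a direct product of cyclic
`p`-groups (written multiplicatively). -/
abbrev SylowFactor (p : ℕ) {n : ℕ} (e : Fin n → ℕ) : Type :=
  (j : Fin n) → Multiplicative (ZMod (p ^ e j))

lemma dvd_order_iff {r : ℕ} (p : Fin r → ℕ) (hp : ∀ i, (p i).Prime) (hpd : Function.Injective p)
    (H : Fin r → Type) [∀ i, CommGroup (H i)] [∀ i, Fintype (H i)] (E : Fin r → ℕ)
    (hE : ∀ i, Fintype.card (H i) = p i ^ E i) (y : ∀ i, H i) (i : Fin r) (d : ℕ) :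
    p i ^ (d + 1) ∣ orderOf y ↔ y i ^ (p i ^ d) ≠ 1 := by
  constructor
  · intro h h1
    have h2 : y ^ (p i ^ d * ∏ j ∈ Finset.univ.erase i, p j ^ E j) = 1 := by
      funext j
      simp only [Pi.pow_apply, Pi.one_apply]
      by_cases hj : j = i
      · subst hj; rw [pow_mul, h1, one_pow]
      · apply orderOf_dvd_iff_pow_eq_one.1
        apply Dvd.dvd.mul_left
        refine (orderOf_dvd_card (x := y j)).trans ?_
        rw [hE]
        exact Finset.dvd_prod_of_mem _ (Finset.mem_erase.2 ⟨hj, Finset.mem_univ _⟩)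
    have h3 := h.trans (orderOf_dvd_of_pow_eq_one h2)
    rw [pow_succ, Nat.mul_dvd_mul_iff_left (pow_pos (hp i).pos d)] at h3
    obtain ⟨j, hj, hjd⟩ := ((hp i).prime.dvd_finsetProd_iff _).1 h3
    have := (Nat.prime_dvd_prime_iff_eq (hp i) (hp j)).1 ((hp i).dvd_of_dvd_pow hjd)
    exact (Finset.mem_erase.1 hj).1 (hpd this).symm
  · intro h
    have h1 : orderOf (y i) ∣ orderOf y := by
      apply orderOf_dvd_of_pow_eq_one
      rw [← Pi.pow_apply, pow_orderOf_eq_one]; rfl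
    refine dvd_trans ?_ h1
    obtain ⟨b, -, hb⟩ := (Nat.dvd_prime_pow (hp i)).1 (hE i ▸ orderOf_dvd_card (x := y i))
    rw [hb]
    apply pow_dvd_pow
    by_contra hlt
    exact h (orderOf_dvd_iff_pow_eq_one.1 (hb ▸ pow_dvd_pow _ (by omega)))

lemma adj_iff {r : ℕ} (p : Fin r → ℕ) (hp : ∀ i, (p i).Prime) (hpd : Function.Injective p)
    (H : Fin r → Type) [∀ i, CommGroup (H i)] [∀ i, Fintype (H i)] (E : Fin r → ℕ)
    (hE : ∀ i, Fintype.card (H i) = p i ^ E i) {σ : Type} [Fintype σ] [DecidableEq σ]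
    (f : σ → Fin r) (hf : Function.Injective f) (c : σ → ℕ) (hc : ∀ s, 1 ≤ c s)
    (m : ℕ) (hm : m = ∏ s, p (f s) ^ c s) (y : ∀ i, H i) :
    (m.gcd (orderOf y) = 1 ∨ (m.gcd (orderOf y)).Prime) ↔
      (∀ s, y (f s) = 1) ∨ ∃ s, (y (f s) ≠ 1 ∧ (2 ≤ c s → y (f s) ^ p (f s) = 1)) ∧
        ∀ t, t ≠ s → y (f t) = 1 := by
  have F1 : ∀ i, p i ∣ orderOf y ↔ y i ≠ 1 := fun i => by
    simpa using dvd_order_iff p hp hpd H E hE y i 0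
  have F2 : ∀ i, p i ^ 2 ∣ orderOf y ↔ y i ^ p i ≠ 1 := fun i => by
    simpa using dvd_order_iff p hp hpd H E hE y i 1
  have M1 : ∀ s, p (f s) ^ c s ∣ m := fun s => hm ▸
    Finset.dvd_prod_of_mem (fun s => p (f s) ^ c s) (Finset.mem_univ s)
  have M0 : ∀ s, p (f s) ∣ m := fun s =>
    (dvd_pow_self _ (by have := hc s; omega)).trans (M1 s)
  have M2 : ∀ q, q.Prime → q ∣ m → ∃ s, q = p (f s) := by
    intro q hq h
    rw [hm] at h
    obtain ⟨s, -, hs⟩ := (hq.prime.dvd_finsetProd_iff _).1 h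
    exact ⟨s, (Nat.prime_dvd_prime_iff_eq hq (hp _)).1 (hq.dvd_of_dvd_pow hs)⟩
  have M3 : ∀ s, p (f s) ^ 2 ∣ m → 2 ≤ c s := by
    intro s h
    by_contra hlt
    have hc1 : c s = 1 := by have := hc s; omega
    rw [hm, ← Finset.mul_prod_erase _ _ (Finset.mem_univ s), hc1, pow_one, pow_two,
      Nat.mul_dvd_mul_iff_left (hp _).pos] at h
    obtain ⟨t, ht, htd⟩ := ((hp _).prime.dvd_finsetProd_iff _).1 h
    have := (Nat.prime_dvd_prime_iff_eq (hp _) (hp _)).1 ((hp _).dvd_of_dvd_pow htd)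
    exact (Finset.mem_erase.1 ht).1 (hf (hpd this)).symm
  set g := m.gcd (orderOf y) with hg
  have hgm : g ∣ m := Nat.gcd_dvd_left _ _
  have hgy : g ∣ orderOf y := Nat.gcd_dvd_right _ _
  constructor
  · intro h
    by_cases h0 : ∀ s, y (f s) = 1
    · exact Or.inl h0
    right
    push Not at h0
    obtain ⟨s, hs⟩ := h0
    have hd : ∀ t, y (f t) ≠ 1 → p (f t) ∣ g := fun t ht => Nat.dvd_gcd (M0 t) ((F1 _).2 ht)
    have hgp : g = p (f s) := by
      rcases h with h | h
      · have := hd s hs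
        rw [h] at this
        exact absurd (Nat.dvd_one.1 this) (hp _).one_lt.ne'
      · exact ((Nat.prime_dvd_prime_iff_eq (hp _) h).1 (hd s hs)).symm
    refine ⟨s, ⟨hs, fun h2 => ?_⟩, fun t hts => ?_⟩
    · by_contra hne
      have h3 : p (f s) ^ 2 ∣ g :=
        Nat.dvd_gcd ((pow_dvd_pow _ h2).trans (M1 s)) ((F2 _).2 hne)
      rw [hgp] at h3
      have := Nat.le_of_dvd (hp _).pos h3
      have := (hp (f s)).one_lt
      nlinarith
    · by_contra hne
      have h3 := hd t hne
      rw [hgp] at h3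
      exact hts (hf (hpd ((Nat.prime_dvd_prime_iff_eq (hp _) (hp _)).1 h3)))
  · rintro (h | ⟨s, ⟨hs, hs2⟩, h⟩)
    · left
      by_contra hne
      obtain ⟨q, hq, hqg⟩ := Nat.exists_prime_and_dvd hne
      obtain ⟨s, rfl⟩ := M2 q hq (hqg.trans hgm)
      exact (F1 _).1 (hqg.trans hgy) (h s)
    · right
      have hdg : p (f s) ∣ g := Nat.dvd_gcd (M0 s) ((F1 _).2 hs)
      obtain ⟨w, hw⟩ := hdg
      have : w = 1 := by
        by_contra hne
        obtain ⟨q, hq, hqw⟩ := Nat.exists_prime_and_dvd hne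
        have hqg : q ∣ g := hw ▸ hqw.mul_left _
        obtain ⟨t, rfl⟩ := M2 q hq (hqg.trans hgm)
        by_cases hts : t = s
        · subst hts
          have h2 : p (f t) ^ 2 ∣ g := by rw [hw, pow_two]; exact Nat.mul_dvd_mul_left _ hqw
          exact (F2 _).1 (h2.trans hgy) (hs2 (M3 t (h2.trans hgm)))
        · exact (F1 _).1 (hqg.trans hgy) (h t hts)
      rw [hw, this, mul_one]
      exact hp _

open Classical in
lemma count_lem {r : ℕ} (H : Fin r → Type) [∀ i, CommGroup (H i)] [∀ i, Fintype (H i)]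
    {σ : Type} [Fintype σ] (f : σ → Fin r) (hf : Function.Injective f)
    (T : ∀ s, H (f s) → Prop) (hT : ∀ s, T s 1) :
    (Finset.univ.filter (fun y : ∀ i, H i => (∀ s, y (f s) = 1) ∨
      ∃ s, (y (f s) ≠ 1 ∧ T s (y (f s))) ∧ ∀ t, t ≠ s → y (f t) = 1)).card *
      ∏ s, Fintype.card (H (f s)) + Fintype.card σ * Fintype.card (∀ i, H i) =
    (1 + ∑ s, (Finset.univ.filter (T s)).card) * Fintype.card (∀ i, H i) := by
  -- fibres over the coordinates in the range of `f`
  let R := {i : Fin r // i ∉ Set.range f}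
  let Q := ((i : R) → H i)
  let F : (∀ i, H i) → ((s : σ) → H (f s)) × Q := fun y => (fun s => y (f s), fun i => y i)
  have hF : Function.Bijective F := by
    constructor
    · intro y z h
      funext i
      by_cases hi : i ∈ Set.range f
      · obtain ⟨s, rfl⟩ := hi
        exact congrFun (congrArg Prod.fst h) s
      · exact congrFun (congrArg Prod.snd h) ⟨i, hi⟩
    · rintro ⟨u, v⟩
      refine ⟨fun i => if h : i ∈ Set.range f then h.choose_spec ▸ u h.choose else v ⟨i, h⟩, ?_⟩
      ext1
      · funext s
        have h : f s ∈ Set.range f := ⟨s, rfl⟩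
        simp only [F]
        rw [dif_pos h]
        have key : ∀ (t : σ) (ht : f t = f s), (ht ▸ u t : H (f s)) = u s := by
          intro t ht
          obtain rfl := hf ht
          rfl
        exact key _ h.choose_spec
      · funext i
        simp only [F]
        rw [dif_neg i.2]
  have hcard : Fintype.card (∀ i, H i) = (∏ s, Fintype.card (H (f s))) * Fintype.card Q := by
    rw [Fintype.card_of_bijective hF, Fintype.card_prod, Fintype.card_pi]
  let B : σ → Finset ((s : σ) → H (f s)) := fun s => Fintype.piFinset (fun t =>
    if h : t = s then (Finset.univ.filter (fun z => z ≠ 1 ∧ T t z)) else {1})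
  have hB : ∀ s u, u ∈ B s ↔ (u s ≠ 1 ∧ T s (u s)) ∧ ∀ t, t ≠ s → u t = 1 := by
    intro s u
    simp only [B, Fintype.mem_piFinset]
    constructor
    · intro h
      refine ⟨by simpa using h s, fun t ht => by simpa [ht] using h t⟩
    · rintro ⟨h1, h2⟩ t
      by_cases ht : t = s
      · subst ht; simpa using h1
      · simpa [ht] using h2 t ht
  have hBc : ∀ s, (B s).card + 1 = (Finset.univ.filter (T s)).card := by
    intro s
    have : (B s).card = ((Finset.univ.filter (T s)).erase 1).card := by
      simp only [B, Fintype.card_piFinset]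
      rw [Finset.prod_eq_single s]
      · simp only [dite_true]
        congr 1
        ext z; simp
      · intro t _ ht; simp [ht]
      · simp
    rw [this, Finset.card_erase_add_one]
    simpa using hT s
  have hbig : (Finset.univ.filter (fun y : ∀ i, H i => (∀ s, y (f s) = 1) ∨
      ∃ s, (y (f s) ≠ 1 ∧ T s (y (f s))) ∧ ∀ t, t ≠ s → y (f t) = 1)).card =
      (1 + ∑ s, (B s).card) * Fintype.card Q := by
    have h1 : (({1} : Finset ((s : σ) → H (f s))) ∪ Finset.univ.biUnion B).card = 1 + ∑ s, (B s).card := by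
      rw [Finset.card_union_of_disjoint, Finset.card_biUnion]
      · simp
      · intro s _ t _ hst
        refine Finset.disjoint_left.2 ?_
        intro u hu hv
        exact ((hB _ _).1 hu).1.1 (((hB _ _).1 hv).2 s hst)
      · rw [Finset.disjoint_left]
        intro u hu hv
        obtain ⟨s, -, hs⟩ := Finset.mem_biUnion.1 hv
        rw [Finset.mem_singleton.1 hu] at hs
        exact ((hB _ _).1 hs).1.1 rfl
    rw [← h1, ← Finset.card_univ (α := Q), ← Finset.card_product]
    apply Finset.card_bijective F hF
    intro y
    simp only [Finset.mem_filter, Finset.mem_univ, true_and, Finset.mem_product, Finset.mem_union,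
      Finset.mem_singleton, Finset.mem_biUnion, hB, and_true, F]
    refine or_congr ?_ Iff.rfl
    constructor
    · intro h; funext s; exact h s
    · intro h s; exact congrFun h s
  rw [hbig, hcard]
  have : ∑ s, (Finset.univ.filter (T s)).card = ∑ s, (B s).card + Fintype.card σ := by
    simp_rw [← hBc]
    simp [Finset.sum_add_distrib]
  rw [this]
  ring

lemma count_lem' {r : ℕ} (H : Fin r → Type) [∀ i, CommGroup (H i)] [∀ i, Fintype (H i)]
    {σ : Type} [Fintype σ] (f : σ → Fin r) (hf : Function.Injective f)
    (T : ∀ s, H (f s) → Prop) (hT : ∀ s, T s 1) :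
    Nat.card {y : ∀ i, H i // (∀ s, y (f s) = 1) ∨
      ∃ s, (y (f s) ≠ 1 ∧ T s (y (f s))) ∧ ∀ t, t ≠ s → y (f t) = 1} *
      ∏ s, Nat.card (H (f s)) + Fintype.card σ * Nat.card (∀ i, H i) =
    (1 + ∑ s, Nat.card {z // T s z}) * Nat.card (∀ i, H i) := by
  classical
  have h := count_lem H f hf T hT
  simp only [← Fintype.card_subtype, ← Nat.card_eq_fintype_card] at h
  rw [← Nat.card_eq_fintype_card (α := σ)]
  exact h

open Classical in
lemma card_tors (p : ℕ) (hp : p.Prime) {n : ℕ} (e : Fin n → ℕ) (he : ∀ j, 1 ≤ e j)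
    [∀ j, Fintype (Multiplicative (ZMod (p ^ e j)))] :
    (Finset.univ.filter (fun y : (j : Fin n) → Multiplicative (ZMod (p ^ e j)) =>
      y ^ p = 1)).card = p ^ n := by
  have h1 : (Finset.univ.filter (fun y : (j : Fin n) → Multiplicative (ZMod (p ^ e j)) =>
      y ^ p = 1)) = Fintype.piFinset (fun j => Finset.univ.filter (fun z => z ^ p = 1)) := by
    ext y
    simp [funext_iff]
  rw [h1, Fintype.card_piFinset]
  have : ∀ j, (Finset.univ.filter (fun z : Multiplicative (ZMod (p ^ e j)) => z ^ p = 1)).card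
      = p := by
    intro j
    have : NeZero (p ^ e j) := ⟨pow_ne_zero _ hp.ne_zero⟩
    have hc : Fintype.card (Multiplicative (ZMod (p ^ e j))) = p ^ e j := by
      rw [← Nat.card_eq_fintype_card]; exact Nat.card_zmod _
    have hd : p ∣ Fintype.card (Multiplicative (ZMod (p ^ e j))) := by
      rw [hc]; exact dvd_pow_self _ (by have := he j; omega)
    have hk := IsCyclic.card_powMonoidHom_ker (G := Multiplicative (ZMod (p ^ e j))) p
    rw [Nat.card_eq_fintype_card (α := Multiplicative (ZMod (p ^ e j))),
      Nat.gcd_eq_right hd] at hk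
    refine Eq.trans ?_ hk
    rw [← Fintype.card_subtype, ← Nat.card_eq_fintype_card]
    rfl
  simp [this]

lemma card_tors' (p : ℕ) (hp : p.Prime) {n : ℕ} (e : Fin n → ℕ) (he : ∀ j, 1 ≤ e j)
    [∀ j, Fintype (Multiplicative (ZMod (p ^ e j)))] :
    Nat.card {y : (j : Fin n) → Multiplicative (ZMod (p ^ e j)) // y ^ p = 1} = p ^ n := by
  classical
  have h := card_tors p hp e he
  rw [← Fintype.card_subtype, ← Nat.card_eq_fintype_card] at h
  exact h

/-- Degree formula (Theorem 3.1(ii)): for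
`G = G₁ × ⋯ × G_r` with `G_i` the Sylow `p_i`-subgroup of rank `n_i`, if
`o(x) = (∏ p_{α_i}) (∏ p_{β_i}^{γ_i})` with all indices distinct, `γ_i ≥ 2` and
`k + l ≥ 2` or `l ≥ 1`, then
`deg(x) = (1 - k - l + ∑ |G_{α_j}| + ∑ p_{β_j}^{n_{β_j}}) ⬝ |G| / ((∏ |G_{α_i}|)(∏ |G_{β_i}|))`.
The formula is stated denominator- and subtraction-free over `ℕ`. -/
theorem degree_formula_abelian
    (r : ℕ) (p : Fin r → ℕ) (hp : ∀ i, (p i).Prime) (hpdist : Function.Injective p)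
    (n : Fin r → ℕ) (e : (i : Fin r) → Fin (n i) → ℕ) (he : ∀ i j, 1 ≤ e i j)
    (k l : ℕ) (α : Fin k → Fin r) (β : Fin l → Fin r)
    (hdist : Function.Injective (Sum.elim α β))
    (γ : Fin l → ℕ) (hγ : ∀ i, 2 ≤ γ i)
    (hkl : 2 ≤ k + l ∨ 1 ≤ l)
    (x : (i : Fin r) → SylowFactor (p i) (e i))
    (hx : orderOf x = (∏ i, p (α i)) * ∏ i, p (β i) ^ γ i) :
    cpoDeg x * ((∏ i, Nat.card (SylowFactor (p (α i)) (e (α i)))) *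
        ∏ i, Nat.card (SylowFactor (p (β i)) (e (β i)))) +
      (k + l) * Nat.card ((i : Fin r) → SylowFactor (p i) (e i)) =
    (1 + (∑ j, Nat.card (SylowFactor (p (α j)) (e (α j)))) + ∑ j, p (β j) ^ n (β j)) *
      Nat.card ((i : Fin r) → SylowFactor (p i) (e i)) := by
  classical
  have hne : ∀ i j, NeZero (p i ^ e i j) := fun i j => ⟨pow_ne_zero _ (hp i).ne_zero⟩
  let _ : ∀ i j, Fintype (Multiplicative (ZMod (p i ^ e i j))) := fun i j => Fintype.ofFinite _
  have hE : ∀ i, Fintype.card (SylowFactor (p i) (e i)) = p i ^ (∑ j, e i j) := by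
    intro i
    rw [Fintype.card_pi, ← Finset.prod_pow_eq_pow_sum]
    refine Finset.prod_congr rfl fun j _ => ?_
    rw [← Nat.card_eq_fintype_card]
    exact Nat.card_zmod _
  let c : Fin k ⊕ Fin l → ℕ := Sum.elim (fun _ => 1) γ
  have hc : ∀ s, 1 ≤ c s := by
    rintro (s | s)
    · exact le_rfl
    · exact (by norm_num : 1 ≤ 2).trans (hγ s)
  have hm : orderOf x = ∏ s, p (Sum.elim α β s) ^ c s := by
    rw [hx, Fintype.prod_sum_type]
    simp [c]
  have hadj := adj_iff p hp hpdist (fun i => SylowFactor (p i) (e i)) _ hE (Sum.elim α β) hdist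
    c hc (orderOf x) hm
  have hxx : ¬ ((orderOf x).gcd (orderOf x) = 1 ∨ ((orderOf x).gcd (orderOf x)).Prime) := by
    rw [hadj x]
    have hone : ∀ s, x (Sum.elim α β s) ≠ 1 := by
      intro s
      have := (dvd_order_iff p hp hpdist (fun i => SylowFactor (p i) (e i)) _ hE x
        (Sum.elim α β s) 0).1
      simp only [zero_add, pow_one, pow_zero] at this
      apply this
      rw [hm]
      exact (dvd_pow_self _ (by have := hc s; omega)).trans
        (Finset.dvd_prod_of_mem (fun s => p (Sum.elim α β s) ^ c s) (Finset.mem_univ s))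
    have htwo : ∀ s, 2 ≤ c s → x (Sum.elim α β s) ^ p (Sum.elim α β s) ≠ 1 := by
      intro s h2
      have := (dvd_order_iff p hp hpdist (fun i => SylowFactor (p i) (e i)) _ hE x
        (Sum.elim α β s) 1).1
      simp only [pow_one] at this
      apply this
      rw [hm]
      exact (pow_dvd_pow _ h2).trans
        (Finset.dvd_prod_of_mem (fun s => p (Sum.elim α β s) ^ c s) (Finset.mem_univ s))
    rintro (h | ⟨s, ⟨-, h2⟩, h⟩)
    · have : Nonempty (Fin k ⊕ Fin l) := by
        rw [← Fintype.card_pos_iff]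
        simp only [Fintype.card_sum, Fintype.card_fin]
        omega
      obtain ⟨s⟩ := this
      exact hone s (h s)
    · have hall : ∀ t, t = s := fun t => by
        by_contra hts
        exact hone t (h t hts)
      rcases s with s | s
      · have h1 : Fintype.card (Fin k ⊕ Fin l) = 1 :=
          Fintype.card_eq_one_iff.2 ⟨_, hall⟩
        simp only [Fintype.card_sum, Fintype.card_fin] at h1
        have hl : 1 ≤ l := by omega
        exact absurd (hall (Sum.inr ⟨0, hl⟩)) (by simp)
      · exact htwo (Sum.inr s) (hγ s) (h2 (hγ s))
  have hcount := count_lem' (fun i => SylowFactor (p i) (e i)) (Sum.elim α β) hdist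
    (fun s z => 2 ≤ c s → z ^ p (Sum.elim α β s) = 1) (fun s _ => one_pow _)
  have hdeg : cpoDeg x = Nat.card {y : (i : Fin r) → SylowFactor (p i) (e i) //
      (∀ s, y (Sum.elim α β s) = 1) ∨
      ∃ s, (y (Sum.elim α β s) ≠ 1 ∧
        (2 ≤ c s → y (Sum.elim α β s) ^ p (Sum.elim α β s) = 1)) ∧
        ∀ t, t ≠ s → y (Sum.elim α β t) = 1} := by
    rw [cpoDeg]
    refine Nat.card_congr (Equiv.subtypeEquivRight fun y => ?_)
    rw [← hadj y]
    constructor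
    · exact fun h => h.2
    · intro h
      refine ⟨?_, h⟩
      rintro rfl
      exact hxx h
  have hA : ∀ j, Nat.card {z : SylowFactor (p (Sum.elim α β (Sum.inl j)))
      (e (Sum.elim α β (Sum.inl j))) // 2 ≤ c (Sum.inl j) →
        z ^ p (Sum.elim α β (Sum.inl j)) = 1} =
      Nat.card (SylowFactor (p (α j)) (e (α j))) := by
    intro j
    refine Nat.card_congr (Equiv.subtypeUnivEquiv fun z h => ?_)
    simp [c] at h
  have hB : ∀ j, Nat.card {z : SylowFactor (p (Sum.elim α β (Sum.inr j)))
      (e (Sum.elim α β (Sum.inr j))) // 2 ≤ c (Sum.inr j) →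
        z ^ p (Sum.elim α β (Sum.inr j)) = 1} = p (β j) ^ n (β j) := by
    intro j
    rw [← card_tors' (p (β j)) (hp _) (e (β j)) (he _)]
    exact Nat.card_congr (Equiv.subtypeEquivRight fun z =>
      ⟨fun h => h (hγ j), fun h _ => h⟩)
  rw [← hdeg, Fintype.prod_sum_type, Fintype.sum_sum_type] at hcount
  rw [Finset.sum_congr rfl fun j _ => hA j, Finset.sum_congr rfl fun j _ => hB j] at hcount
  simp only [Fintype.card_sum, Fintype.card_fin, Sum.elim_inl, Sum.elim_inr] at hcount
  rw [hcount]
  ring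
end

section
/- Let D_n = ⟨f, r | f² = rⁿ = 1, rf = fr⁻¹⟩ be the dihedral group of order 2n, and let ⟨r⟩ ≅ Z_n be its cyclic subgroup of rotations. If x = r^j is a rotation whose order is not equal to 2, then the degree of x in the co-prime order graph Θ(D_n) equals n plus the degree of r^j regarded as a vertex of the co-prime order graph Θ(⟨r⟩); that is, deg_{Θ(D_n)}(x) − deg_{Θ(Z_n)}(x) = n. -/
theorem orderOf_r_ofAdd {n : ℕ} (i : ZMod n) :
    orderOf (Multiplicative.ofAdd i) = orderOf (DihedralGroup.r i : DihedralGroup n) := by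
  rw [orderOf_eq_orderOf_iff]
  intro k
  rw [DihedralGroup.r_pow, DihedralGroup.one_def, ← ofAdd_nsmul, ofAdd_eq_one, nsmul_eq_mul,
    DihedralGroup.r.injEq, mul_comm]

theorem adj_r_r {n : ℕ} (i j : ZMod n) :
    (coprimeOrderGraph (DihedralGroup n)).Adj (DihedralGroup.r j) (DihedralGroup.r i) ↔
      (coprimeOrderGraph (Multiplicative (ZMod n))).Adj (Multiplicative.ofAdd j)
        (Multiplicative.ofAdd i) := by
  simp [coprimeOrderGraph, ← orderOf_r_ofAdd]

theorem adj_r_sr {n : ℕ} (i j : ZMod n) :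
    (coprimeOrderGraph (DihedralGroup n)).Adj (DihedralGroup.r j) (DihedralGroup.sr i) := by
  refine ⟨by simp, ?_⟩
  rw [DihedralGroup.orderOf_sr]
  rcases (Nat.dvd_prime Nat.prime_two).1
    (Nat.gcd_dvd_right (orderOf (DihedralGroup.r j : DihedralGroup n)) 2) with h | h
  · exact Or.inl h
  · exact Or.inr (by rw [h]; exact Nat.prime_two)

/-- Neighbors of a rotation: all reflections, plus the neighbors among rotations. -/
def neighborEquiv {n : ℕ} (j : ZMod n) :
    ZMod n ⊕ (coprimeOrderGraph (Multiplicative (ZMod n))).neighborSet (Multiplicative.ofAdd j) ≃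
      (coprimeOrderGraph (DihedralGroup n)).neighborSet (DihedralGroup.r j) where
  toFun
    | Sum.inl i => ⟨DihedralGroup.sr i, adj_r_sr i j⟩
    | Sum.inr i => ⟨DihedralGroup.r i.1.toAdd, (adj_r_r _ j).2 i.2⟩
  invFun
    | ⟨DihedralGroup.sr i, _⟩ => Sum.inl i
    | ⟨DihedralGroup.r i, h⟩ => Sum.inr ⟨Multiplicative.ofAdd i, (adj_r_r i j).1 h⟩
  left_inv := by rintro (i | i) <;> rfl
  right_inv := by rintro ⟨i | i, h⟩ <;> rfl

/-- For a rotation `r^j` of the dihedral group `D_n` whose order is not `2`, the degree of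
`r^j` in `Θ(D_n)` exceeds the degree of the corresponding element of the rotation subgroup
`⟨r⟩ ≅ Z_n` in `Θ(Z_n)` by exactly `n`. -/
theorem degree_dihedral_rotation (n : ℕ) (hn : 0 < n) (j : ZMod n)
    (hx : orderOf (DihedralGroup.r j : DihedralGroup n) ≠ 2) :
    cpoDeg (DihedralGroup.r j : DihedralGroup n) =
      n + cpoDeg (Multiplicative.ofAdd j) := by
  have : NeZero n := ⟨hn.ne'⟩
  unfold cpoDeg
  have : Finite (Multiplicative (ZMod n)) := inferInstanceAs (Finite (ZMod n))
  rw [← Nat.card_congr (neighborEquiv j), Nat.card_sum, Nat.card_zmod]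
end

section
/- Let p be a prime and t ≥ 1. The characteristic polynomial of the Laplacian matrix of the co-prime order graph Θ((Z_p)^t) of the elementary abelian group (Z_p)^t is x·(x − p^t)^{p^t − 1}; that is, the Laplacian eigenvalues of Θ((Z_p)^t) are 0 with multiplicity 1 and p^t with multiplicity p^t − 1. -/
open Polynomial

open scoped Classical in
/-- The Laplacian matrix `D - A` of the co-prime order graph of a finite group `G`. -/
noncomputable def cpoLap (G : Type*) [Group G] [Fintype G] : Matrix G G ℝ :=
  Matrix.of fun x y =>
    if x = y then (cpoDeg x : ℝ) else if (coprimeOrderGraph G).Adj x y then -1 else 0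

theorem epa_adj (p t : ℕ) [Fact p.Prime] (x y : Fin t → Multiplicative (ZMod p)) (h : x ≠ y) :
    (coprimeOrderGraph (Fin t → Multiplicative (ZMod p))).Adj x y := by
  have hp : p.Prime := Fact.out
  refine ⟨h, ?_⟩
  have hx : orderOf x ∣ p := by
    apply orderOf_dvd_of_pow_eq_one
    funext i
    apply Multiplicative.toAdd.injective
    simp
  have hd := (Nat.gcd_dvd_left (orderOf x) (orderOf y)).trans hx
  rcases (Nat.dvd_prime hp).1 hd with h1 | h1
  · exact Or.inl h1
  · right
    rw [h1]
    exact hp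

theorem epa_deg (p t : ℕ) [Fact p.Prime] (x : Fin t → Multiplicative (ZMod p)) :
    (cpoDeg x : ℝ) = (p : ℝ) ^ t - 1 := by
  have hp : p.Prime := Fact.out
  have hs : (coprimeOrderGraph (Fin t → Multiplicative (ZMod p))).neighborSet x = {x}ᶜ := by
    ext y
    simp only [SimpleGraph.mem_neighborSet, Set.mem_compl_iff, Set.mem_singleton_iff]
    exact ⟨fun h e => h.1 e.symm, fun h => epa_adj p t x y (fun e => h e.symm)⟩
  have hc : Nat.card (Fin t → Multiplicative (ZMod p)) = p ^ t := by
    simp [Nat.card_eq_fintype_card, ZMod.card]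
  have h2 := Set.ncard_add_ncard_compl ({x} : Set (Fin t → Multiplicative (ZMod p)))
  rw [Set.ncard_singleton, hc] at h2
  unfold cpoDeg
  rw [hs, Nat.card_coe_set_eq]
  have h3 : (1 : ℝ) + (({x}ᶜ : Set (Fin t → Multiplicative (ZMod p))).ncard : ℝ) = (p : ℝ) ^ t := by
    exact_mod_cast h2
  linarith

theorem epa_lap (p t : ℕ) [Fact p.Prime] :
    cpoLap (Fin t → Multiplicative (ZMod p)) =
      Matrix.vecMulVec (fun _ => -1) (fun _ => 1) -
        Matrix.scalar (Fin t → Multiplicative (ZMod p)) (-(p : ℝ) ^ t) := by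
  ext x y
  by_cases h : x = y
  · subst h
    simp [cpoLap, epa_deg, Matrix.vecMulVec_apply]
    ring
  · simp [cpoLap, h, epa_adj p t x y h, Matrix.vecMulVec_apply]

/-- The Laplacian spectrum of `Θ((Z_p)^t)` for `p` prime and `t ≥ 1`: the characteristic
polynomial of the Laplacian matrix is `x (x - p^t)^(p^t - 1)`. -/
theorem lap_charpoly_elementary_abelian (p t : ℕ) [Fact p.Prime] (ht : 1 ≤ t) :
    (cpoLap (Fin t → Multiplicative (ZMod p))).charpoly =
      X * (X - C ((p : ℝ) ^ t)) ^ (p ^ t - 1) := by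
  have hp : p.Prime := Fact.out
  have hc : Fintype.card (Fin t → Multiplicative (ZMod p)) = p ^ t := by
    simp [ZMod.card]
  rw [epa_lap, Matrix.charpoly_sub_scalar, Matrix.charpoly_vecMulVec, hc]
  obtain ⟨m, hm⟩ : ∃ m, p ^ t = m + 1 := ⟨p ^ t - 1, by have := pow_pos hp.pos t; omega⟩
  have hm' : (p : ℝ) ^ t = m + 1 := by exact_mod_cast hm
  have hdot : ((fun _ => -1 : (Fin t → Multiplicative (ZMod p)) → ℝ) ⬝ᵥ fun _ => 1)
      = -(p : ℝ) ^ t := by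
    simp [dotProduct, ZMod.card]
  rw [hdot, hm', hm, Nat.add_sub_cancel]
  simp only [sub_comp, mul_comp, neg_comp, C_comp, pow_comp, X_comp, smul_eq_C_mul, C_neg]
  ring
end

section
/- Let p be a prime, n ≥ 1, and let G = Z_{p^{α₁}} × Z_{p^{α₂}} × ⋯ × Z_{p^{αₙ}} be a finite abelian p-group with max(α₁, α₂, …, αₙ) ≥ 2, and write N = α₁ + α₂ + ⋯ + αₙ (so |G| = p^N). The characteristic polynomial of the Laplacian matrix of the co-prime order graph Θ(G) is x·(x − p^N)^{pⁿ}·(x − pⁿ)^{p^N − pⁿ − 1}; that is, the Laplacian eigenvalues of Θ(G) are 0 with multiplicity 1, p^N with multiplicity pⁿ, and pⁿ with multiplicity p^N − pⁿ − 1. -/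
open Polynomial

lemma det_two_block {V : Type*} [Fintype V] [DecidableEq V] (S : Finset V)
    (a b : ℝ) (ha : a ≠ 0) (hb : b ≠ 0) :
    (Matrix.of fun x y : V => (if x = y then (if x ∈ S then a else b) else 0) +
      (if x ∈ S ∨ y ∈ S then (1 : ℝ) else 0)).det =
      a ^ S.card * b ^ Sᶜ.card *
        (1 + S.card / a - (S.card / a) * (Sᶜ.card / b)) := by
  set d : V → ℝ := fun x => if x ∈ S then a else b with hd
  have hd0 : ∀ x, d x ≠ 0 := by intro x; simp only [hd]; split_ifs <;> assumption
  set U : Matrix V (Fin 2) ℝ := Matrix.of fun x => ![1, if x ∈ S then 0 else -1] with hU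
  set W : Matrix (Fin 2) V ℝ := Matrix.of ![fun _ => 1, fun x => if x ∈ S then 0 else 1] with hW
  have h1 : (Matrix.of fun x y : V => (if x = y then (if x ∈ S then a else b) else 0) +
      (if x ∈ S ∨ y ∈ S then (1 : ℝ) else 0)) = Matrix.diagonal d + U * W := by
    ext x y
    simp only [Matrix.of_apply, Matrix.add_apply, Matrix.mul_apply, Fin.sum_univ_two, hU, hW,
      Matrix.diagonal_apply, hd]
    by_cases hx : x ∈ S <;> by_cases hy : y ∈ S <;> simp [hx, hy]
  have hdet : (Matrix.diagonal d).det = a ^ S.card * b ^ Sᶜ.card := by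
    rw [Matrix.det_diagonal, ← Finset.prod_mul_prod_compl S]
    congr 1
    · rw [Finset.prod_congr rfl (g := fun _ => a)]
      · simp
      · intro x hx; simp [hd, hx]
    · rw [Finset.prod_congr rfl (g := fun _ => b)]
      · simp
      · intro x hx; simp only [Finset.mem_compl] at hx; simp [hd, hx]
  have hinv : (Matrix.diagonal d)⁻¹ = Matrix.diagonal (fun x => (d x)⁻¹) := by
    apply Matrix.inv_eq_left_inv
    rw [Matrix.diagonal_mul_diagonal, ← Matrix.diagonal_one]
    congr 1; ext x; exact inv_mul_cancel₀ (hd0 x)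
  have hs1 : ∑ x, (d x)⁻¹ = S.card / a + Sᶜ.card / b := by
    rw [← Finset.sum_add_sum_compl S]
    congr 1
    · rw [Finset.sum_congr rfl (g := fun _ => a⁻¹)]
      · simp [div_eq_mul_inv]
      · intro x hx; simp [hd, hx]
    · rw [Finset.sum_congr rfl (g := fun _ => b⁻¹)]
      · simp [div_eq_mul_inv]
      · intro x hx; simp only [Finset.mem_compl] at hx; simp [hd, hx]
  have hs2 : ∑ x, (if x ∈ S then 0 else (d x)⁻¹) = Sᶜ.card / b := by
    rw [← Finset.sum_add_sum_compl S, Finset.sum_eq_zero, zero_add]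
    · rw [Finset.sum_congr rfl (g := fun _ => b⁻¹)]
      · simp [div_eq_mul_inv]
      · intro x hx; simp only [Finset.mem_compl] at hx; simp [hd, hx]
    · intro x hx; simp [hx]
  rw [h1, Matrix.det_add_mul U W, hdet, hinv]
  · congr 1
    have e : W * Matrix.diagonal (fun x => (d x)⁻¹) * U =
        !![(S.card / a + Sᶜ.card / b : ℝ), -(Sᶜ.card / b); Sᶜ.card / b, -(Sᶜ.card / b)] := by
      ext i j
      rw [Matrix.mul_apply]
      simp only [Matrix.mul_diagonal]
      fin_cases i <;> fin_cases j <;>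
        simp only [← hs2, hU, hW, Matrix.of_apply, ← Finset.sum_neg_distrib] <;>
        simp <;>
        first
        | (rw [hs2, hs1]; done)
        | (rw [← Finset.sum_neg_distrib]; apply Finset.sum_congr rfl; intro x _; split_ifs <;> simp; done)
        | (apply Finset.sum_congr rfl; intro x _; split_ifs <;> simp)
    rw [e, Matrix.det_fin_two]
    simp
    ring
  · rw [hdet]
    exact (mul_ne_zero (pow_ne_zero _ ha) (pow_ne_zero _ hb)).isUnit

lemma charpoly_two_block {V : Type*} [Fintype V] [DecidableEq V] (S : Finset V)
    (hm : 1 ≤ Sᶜ.card) (M : Matrix V V ℝ)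
    (hM : ∀ x y, M x y = if x = y then (if x ∈ S then (S.card + Sᶜ.card - 1 : ℝ) else S.card)
      else if x ∈ S ∨ y ∈ S then -1 else 0) :
    M.charpoly = X * (X - C ((S.card + Sᶜ.card : ℝ))) ^ S.card *
      (X - C (S.card : ℝ)) ^ (Sᶜ.card - 1) := by
  apply Polynomial.eq_of_infinite_eval_eq
  have hfin : ({(S.card + Sᶜ.card : ℝ), (S.card : ℝ)} : Set ℝ).Finite := by simp
  refine hfin.infinite_compl.mono ?_
  intro t ht
  simp only [Set.mem_compl_iff, Set.mem_insert_iff, Set.mem_singleton_iff, not_or] at ht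
  have ha := sub_ne_zero.mpr ht.1
  have hb := sub_ne_zero.mpr ht.2
  simp only [Set.mem_ofPred_eq, Matrix.eval_charpoly]
  have key := det_two_block S _ _ ha hb
  have e : Matrix.scalar V t - M = Matrix.of fun x y : V =>
      (if x = y then (if x ∈ S then t - (S.card + Sᶜ.card : ℝ) else t - S.card) else 0) +
      (if x ∈ S ∨ y ∈ S then (1 : ℝ) else 0) := by
    ext x y
    simp only [Matrix.sub_apply, hM, Matrix.of_apply, Matrix.scalar_apply, Matrix.diagonal_apply]
    by_cases hxy : x = y
    · subst hxy
      by_cases hx : x ∈ S <;> simp [hx] 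
      ring
    · by_cases hx : x ∈ S <;> by_cases hy : y ∈ S <;> simp [hx, hy, hxy]
  rw [e, key]
  obtain ⟨m, hm'⟩ : ∃ m, Sᶜ.card = m + 1 := ⟨_, (Nat.sub_add_cancel hm).symm⟩
  rw [hm'] at ha ⊢
  simp only [eval_mul, eval_X, eval_pow, eval_sub, eval_C, Nat.add_sub_cancel, pow_succ]
  field_simp
  push_cast
  ring

lemma adj_iff_p {G : Type*} [Group G] {p : ℕ} (hp : p.Prime)
    (hG : IsPGroup p G) (x y : G) :
    (coprimeOrderGraph G).Adj x y ↔ x ≠ y ∧ (x ^ p = 1 ∨ y ^ p = 1) := by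
  have : Fact p.Prime := ⟨hp⟩
  obtain ⟨i, hi⟩ := IsPGroup.iff_orderOf.mp hG x
  obtain ⟨j, hj⟩ := IsPGroup.iff_orderOf.mp hG y
  have h1 : ∀ k, p ^ k ∣ p ↔ k ≤ 1 := by
    intro k
    conv_lhs => rw [← pow_one p, ← pow_mul, one_mul]
    exact Nat.pow_dvd_pow_iff_le_right hp.one_lt
  have hg : ∀ i j, i ≤ j → (p ^ i).gcd (p ^ j) = p ^ i := fun i j h =>
    Nat.gcd_eq_left (pow_dvd_pow p h)
  have hk : ∀ k, (p ^ k = 1 ∨ (p ^ k).Prime) ↔ k ≤ 1 := by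
    intro k
    constructor
    · rintro (h | h)
      · rcases Nat.pow_eq_one.mp h with h | h
        · exact absurd h hp.ne_one
        · omega
      · exact (Nat.Prime.eq_one_of_pow h).le
    · intro h
      interval_cases k <;> simp [hp]
  change (x ≠ y ∧ _) ↔ _
  rw [← orderOf_dvd_iff_pow_eq_one, ← orderOf_dvd_iff_pow_eq_one, hi, hj, h1, h1]
  rcases le_total i j with h | h
  · rw [hg i j h, hk]
    constructor
    · rintro ⟨a, b⟩; exact ⟨a, Or.inl b⟩
    · rintro ⟨a, b⟩; exact ⟨a, by omega⟩
  · rw [Nat.gcd_comm, hg j i h, hk]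
    constructor
    · rintro ⟨a, b⟩; exact ⟨a, Or.inr b⟩
    · rintro ⟨a, b⟩; exact ⟨a, by omega⟩

lemma cpoLap_charpoly_p {G : Type*} [Group G] [Fintype G] [DecidableEq G] {p : ℕ} (hp : p.Prime)
    (hG : IsPGroup p G) (k m : ℕ) (hk : (Finset.univ.filter fun x : G => x ^ p = 1).card = k)
    (hc : Fintype.card G = k + m) (hm : 1 ≤ m) :
    (cpoLap G).charpoly = X * (X - C ((k + m : ℝ))) ^ k * (X - C (k : ℝ)) ^ (m - 1) := by
  set S : Finset G := Finset.univ.filter fun x : G => x ^ p = 1 with hS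
  have hmS : ∀ x, x ∈ S ↔ x ^ p = 1 := by simp [hS]
  have hSc : Sᶜ.card = m := by rw [Finset.card_compl, hc, hk]; omega
  have hdeg : ∀ x : G, (cpoDeg x : ℝ) = if x ∈ S then (S.card + Sᶜ.card - 1 : ℝ) else S.card := by
    intro x
    unfold cpoDeg
    split_ifs with hx
    · have : (coprimeOrderGraph G).neighborSet x = ((Finset.univ.erase x : Finset G) : Set G) := by
        ext y
        simp only [SimpleGraph.mem_neighborSet, adj_iff_p hp hG, ← hmS, hx, true_or, and_true]
        simp [eq_comm]
      rw [this, Nat.card_coe_set_eq, Set.ncard_coe_finset, Finset.card_erase_of_mem (Finset.mem_univ _),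
        Finset.card_univ, hc, hk, hSc, Nat.cast_sub (by omega)]
      push_cast; ring
    · have : (coprimeOrderGraph G).neighborSet x = (S : Set G) := by
        ext y
        simp only [SimpleGraph.mem_neighborSet, adj_iff_p hp hG, ← hmS, hx, false_or, Finset.mem_coe]
        constructor
        · exact fun h => h.2
        · exact fun h => ⟨fun e => hx (e ▸ h), h⟩
      rw [this, Nat.card_coe_set_eq, Set.ncard_coe_finset]
  have := charpoly_two_block S (by omega) (cpoLap G) (by
    intro x y
    simp only [cpoLap, Matrix.of_apply, hdeg, adj_iff_p hp hG, hmS]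
    by_cases hxy : x = y <;> simp [hxy])
  rw [this, hSc, hk]

lemma card_pow_eq_one_pi (p n : ℕ) [Fact p.Prime]
    (α : Fin n → ℕ) (hα : ∀ i, 1 ≤ α i) :
    (Finset.univ.filter fun x : (i : Fin n) → Multiplicative (ZMod (p ^ α i)) => x ^ p = 1).card
      = p ^ n := by
  have h : (Finset.univ.filter fun x : (i : Fin n) → Multiplicative (ZMod (p ^ α i)) => x ^ p = 1)
      = Fintype.piFinset fun i => Finset.univ.filter
        fun x : Multiplicative (ZMod (p ^ α i)) => x ^ p = 1 := by
    ext x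
    simp [funext_iff]
  rw [h, Fintype.card_piFinset, Finset.prod_congr rfl (g := fun _ => p)]
  · simp
  · intro i _
    have := IsCyclic.card_powMonoidHom_ker (G := Multiplicative (ZMod (p ^ α i))) p
    rw [Nat.card_eq_fintype_card (α := Multiplicative (ZMod (p ^ α i))), Fintype.card_multiplicative, ZMod.card,
      Nat.gcd_eq_right (dvd_pow_self p (by have := hα i; omega))] at this
    refine Eq.trans ?_ this
    rw [← SetLike.coe_sort_coe, Nat.card_coe_set_eq, ← Set.ncard_coe_finset]
    congr 1
    ext x
    simp [MonoidHom.mem_ker]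

/-- The Laplacian spectrum of `Θ(G)` for the abelian `p`-group
`G = Z_{p^{α₁}} × ⋯ × Z_{p^{αₙ}}` with `max αᵢ ≥ 2` and `N = α₁ + ⋯ + αₙ`:
the characteristic polynomial of the Laplacian matrix is
`x (x - p^N)^(pⁿ) (x - pⁿ)^(p^N - pⁿ - 1)`. -/
theorem lap_charpoly_abelian_p_group (p n : ℕ) [Fact p.Prime] (hn : 1 ≤ n)
    (α : Fin n → ℕ) (hα : ∀ i, 1 ≤ α i) (hmax : ∃ i, 2 ≤ α i) :
    (cpoLap ((i : Fin n) → Multiplicative (ZMod (p ^ α i)))).charpoly =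
      X * (X - C ((p : ℝ) ^ (∑ i, α i))) ^ (p ^ n) *
        (X - C ((p : ℝ) ^ n)) ^ (p ^ (∑ i, α i) - p ^ n - 1) := by
  have hp : p.Prime := Fact.out
  have hcard : Fintype.card ((i : Fin n) → Multiplicative (ZMod (p ^ α i))) = p ^ (∑ i, α i) := by
    rw [Fintype.card_pi, ← Finset.prod_pow_eq_pow_sum]
    apply Finset.prod_congr rfl
    intro i _
    rw [Fintype.card_multiplicative, ZMod.card]
  have hG : IsPGroup p ((i : Fin n) → Multiplicative (ZMod (p ^ α i))) :=
    IsPGroup.of_card (n := ∑ i, α i) (by rw [Nat.card_eq_fintype_card, hcard])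
  have hlt : p ^ n < p ^ (∑ i, α i) := by
    apply Nat.pow_lt_pow_right hp.one_lt
    obtain ⟨j, hj⟩ := hmax
    calc n = ∑ _i : Fin n, 1 := by simp
      _ < ∑ i, α i := Finset.sum_lt_sum (fun i _ => hα i) ⟨j, Finset.mem_univ _, hj⟩
  have := cpoLap_charpoly_p hp hG (p ^ n) (p ^ (∑ i, α i) - p ^ n)
    (by convert card_pow_eq_one_pi p n α hα) (by rw [hcard]; omega) (by omega)
  rw [Nat.cast_sub hlt.le] at this
  push_cast at this
  rw [add_sub_cancel] at this
  convert this
end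

section
/- Let p and q be distinct primes and s, t ≥ 1, and let G = (Z_p)^t × (Z_q)^s. The characteristic polynomial of the Laplacian matrix of the co-prime order graph Θ(G) is x·(x − p^t q^s)^{p^t + q^s − 1}·(x − (p^t + q^s − 1))^{p^t q^s − p^t − q^s}; that is, the Laplacian eigenvalues of Θ(G) are 0 with multiplicity 1, p^t q^s with multiplicity p^t + q^s − 1, and p^t + q^s − 1 with multiplicity p^t q^s − p^t − q^s. -/
open Polynomial

lemma det_aux {V : Type*} [Fintype V] [DecidableEq V] (P : V → Prop) [DecidablePred P]
    (a b : ℝ) (ha : a ≠ 0) (hb : b ≠ 0) (k l : ℕ)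
    (hk : (Finset.univ.filter (fun x => ¬ P x)).card = k)
    (hl : (Finset.univ.filter P).card = l) :
    (Matrix.of (fun i j : V => (if i = j then (if P i then b else a) else 0) + 1
      - (if P i ∧ P j then (1 : ℝ) else 0))).det
      = a ^ k * b ^ l * (1 + k / a - (k / a) * (l / b)) := by
  let D : Matrix V V ℝ := Matrix.diagonal (fun i => if P i then b else a)
  let U : Matrix V (Fin 2) ℝ := Matrix.of fun i => ![1 / (if P i then b else a), (if P i then 1 / b else 0)]
  let W : Matrix (Fin 2) V ℝ := Matrix.of ![fun _ => 1, fun j => if P j then -1 else 0]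
  have h : (Matrix.of (fun i j : V => (if i = j then (if P i then b else a) else 0) + 1
      - (if P i ∧ P j then (1 : ℝ) else 0))) = D * (1 + U * W) := by
    ext i j
    rw [Matrix.diagonal_mul]
    simp only [Matrix.add_apply, Matrix.one_apply, Matrix.mul_apply,
      Fin.sum_univ_two, U, W, Matrix.of_apply]
    by_cases h1 : P i <;> by_cases h2 : P j <;> by_cases h3 : i = j <;> simp [h1, h2, h3] <;>
      (try subst h3) <;> (try simp_all) <;> field_simp <;> ring
  rw [h, Matrix.det_mul, Matrix.det_one_add_mul_comm, Matrix.det_fin_two]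
  have hsum : ∀ c d : ℝ, ∑ i : V, (if P i then c else d) = l * c + k * d := by
    intro c d
    rw [Finset.sum_ite, Finset.sum_const, Finset.sum_const, hk, hl]
    simp
  have e00 : (W * U) 0 0 = l / b + k / a := by
    have := hsum (1 / b) (1 / a)
    simp only [Matrix.mul_apply, U, W, Matrix.of_apply]
    simp only [Matrix.cons_val_zero, one_mul]
    rw [show (l : ℝ) / b + k / a = l * (1 / b) + k * (1 / a) by ring, ← this]
    exact Finset.sum_congr rfl fun i _ => by split_ifs <;> rfl
  have e01 : (W * U) 0 1 = l / b := by
    have := hsum (1 / b) 0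
    simp only [Matrix.mul_apply, U, W, Matrix.of_apply]
    rw [show (l : ℝ) / b = l * (1 / b) + k * 0 by ring, ← this]
    exact Finset.sum_congr rfl fun i _ => by by_cases h : P i <;> simp [h]
  have e10 : (W * U) 1 0 = - (l / b) := by
    have := hsum (- (1 / b)) 0
    simp only [Matrix.mul_apply, U, W, Matrix.of_apply]
    rw [show -((l : ℝ) / b) = l * (-(1 / b)) + k * 0 by ring, ← this]
    exact Finset.sum_congr rfl fun i _ => by by_cases h : P i <;> simp [h]
  have e11 : (W * U) 1 1 = - (l / b) := by
    have := hsum (- (1 / b)) 0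
    simp only [Matrix.mul_apply, U, W, Matrix.of_apply]
    rw [show -((l : ℝ) / b) = l * (-(1 / b)) + k * 0 by ring, ← this]
    exact Finset.sum_congr rfl fun i _ => by by_cases h : P i <;> simp [h]
  have hD : D.det = a ^ k * b ^ l := by
    simp only [D, Matrix.det_diagonal]
    rw [Finset.prod_ite, Finset.prod_const, Finset.prod_const, hk, hl, mul_comm]
  simp only [Matrix.add_apply, e00, e01, e10, e11, hD]
  simp
  left
  ring

lemma charpoly_aux {G : Type*} [Group G] [Fintype G] [DecidableEq G] (P : G → Prop)
    [DecidablePred P]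
    (hadj : ∀ x y, (coprimeOrderGraph G).Adj x y ↔ x ≠ y ∧ ¬ (P x ∧ P y)) (k l : ℕ)
    (hk : (Finset.univ.filter (fun x => ¬ P x)).card = k)
    (hl : (Finset.univ.filter P).card = l + 1) :
    (cpoLap G).charpoly = X * (X - C ((k : ℝ) + l + 1)) ^ k * (X - C (k : ℝ)) ^ l := by
  have hcard : Fintype.card G = k + l + 1 := by
    have := Finset.card_filter_add_card_filter_not (s := (Finset.univ : Finset G)) P
    rw [hk, hl, Finset.card_univ] at this
    omega
  have hdeg : ∀ x, (cpoDeg x : ℝ) = if P x then (k : ℝ) else k + l := by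
    intro x
    have : cpoDeg x = if P x then k else k + l := by
      unfold cpoDeg
      rw [Nat.card_coe_set_eq]
      split_ifs with h
      · rw [← hk, ← Set.ncard_coe_finset]
        congr 1
        ext y
        simp only [SimpleGraph.mem_neighborSet, hadj, Finset.coe_filter, Finset.mem_univ, true_and,
          Set.mem_ofPred_eq, h]
        constructor
        · exact fun h => h.2
        · exact fun h' => ⟨fun e => h' (e ▸ h), h'⟩
      · have : (coprimeOrderGraph G).neighborSet x = ((Finset.univ.erase x : Finset G) : Set G) := by
          ext y
          simp [hadj, h, eq_comm]
        rw [this, Set.ncard_coe_finset, Finset.card_erase_of_mem (Finset.mem_univ _),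
          Finset.card_univ, hcard]
        omega
    rw [this]; split_ifs <;> simp
  apply Polynomial.eq_of_infinite_eval_eq
  apply Set.Infinite.mono (s := ({(k : ℝ) + l + 1, (k : ℝ)} : Set ℝ)ᶜ)
  swap
  · exact (Set.toFinite _).infinite_compl
  intro x hx
  simp only [Set.mem_compl_iff, Set.mem_insert_iff, Set.mem_singleton_iff, not_or] at hx
  have ha : x - (k + l + 1) ≠ 0 := sub_ne_zero.2 hx.1
  have hb : x - k ≠ 0 := sub_ne_zero.2 hx.2
  have hM := det_aux P _ _ ha hb k (l + 1) hk hl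
  simp only [Set.mem_ofPred_eq, Matrix.eval_charpoly]
  have : Matrix.scalar G x - cpoLap G = (Matrix.of (fun i j : G =>
      (if i = j then (if P i then x - k else x - (k + l + 1)) else 0) + 1
      - (if P i ∧ P j then (1 : ℝ) else 0))) := by
    ext i j
    simp only [cpoLap, Matrix.sub_apply, Matrix.scalar_apply, Matrix.diagonal_apply,
      Matrix.of_apply, hadj, hdeg]
    by_cases h3 : i = j
    · subst h3
      by_cases h1 : P i <;> simp [h1]
      ring
    · by_cases h1 : P i <;> by_cases h2 : P j <;> simp [h1, h2, h3]
  rw [this, hM]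
  simp only [eval_mul, eval_pow, eval_sub, eval_X, eval_C, pow_succ]
  push_cast
  field_simp
  ring

lemma orderOf_aux (p t : ℕ) [Fact p.Prime] (x : Fin t → Multiplicative (ZMod p)) (h : x ≠ 1) :
    orderOf x = p := by
  apply orderOf_eq_prime _ h
  ext i
  change Multiplicative.toAdd (x i ^ p) = 0
  simp

/-- The Laplacian spectrum of `Θ((Z_p)^t × (Z_q)^s)` for distinct primes `p, q` and
`s, t ≥ 1`: the characteristic polynomial of the Laplacian matrix is
`x (x - p^t q^s)^(p^t + q^s - 1) (x - (p^t + q^s - 1))^(p^t q^s - p^t - q^s)`. -/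
theorem lap_charpoly_pq (p q t s : ℕ) [Fact p.Prime] [Fact q.Prime] (hpq : p ≠ q)
    (ht : 1 ≤ t) (hs : 1 ≤ s) :
    (cpoLap ((Fin t → Multiplicative (ZMod p)) × (Fin s → Multiplicative (ZMod q)))).charpoly =
      X * (X - C ((p : ℝ) ^ t * (q : ℝ) ^ s)) ^ (p ^ t + q ^ s - 1) *
        (X - C ((p : ℝ) ^ t + (q : ℝ) ^ s - 1)) ^ (p ^ t * q ^ s - p ^ t - q ^ s) := by
  classical
  have hp : p.Prime := Fact.out
  have hq : q.Prime := Fact.out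
  have hcop : Nat.Coprime p q := (Nat.coprime_primes hp hq).2 hpq
  have hcop' := hcop.symm
  have hnp : ¬ (p * q).Prime := Nat.not_prime_mul hp.one_lt.ne' hq.one_lt.ne'
  have hn1 : p * q ≠ 1 := by
    have := hp.one_lt
    intro h
    have := Nat.eq_one_of_mul_eq_one_right h
    omega
  have hpt : 2 ≤ p ^ t := hp.two_le.trans (Nat.le_self_pow (by omega) p)
  have hqs : 2 ≤ q ^ s := hq.two_le.trans (Nat.le_self_pow (by omega) q)
  have hle : p ^ t + q ^ s ≤ p ^ t * q ^ s := by nlinarith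
  have hord : ∀ x : (Fin t → Multiplicative (ZMod p)) × (Fin s → Multiplicative (ZMod q)),
      orderOf x = (if x.1 = 1 then 1 else p) * (if x.2 = 1 then 1 else q) := by
    intro x
    rw [Prod.orderOf]
    by_cases h1 : x.1 = 1 <;> by_cases h2 : x.2 = 1
    · simp [h1, h2]
    · simp [h1, h2, orderOf_aux]
    · simp [h1, h2, orderOf_aux]
    · simp [h1, h2, orderOf_aux, hcop.lcm_eq_mul]
  have hcp : Fintype.card (Fin t → Multiplicative (ZMod p)) = p ^ t := by
    simp [Fintype.card_multiplicative, ZMod.card]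
  have hcq : Fintype.card (Fin s → Multiplicative (ZMod q)) = q ^ s := by
    simp [Fintype.card_multiplicative, ZMod.card]
  have hl : (Finset.univ.filter
      (fun x : (Fin t → Multiplicative (ZMod p)) × (Fin s → Multiplicative (ZMod q)) =>
        x.1 ≠ 1 ∧ x.2 ≠ 1)).card = (p ^ t - 1) * (q ^ s - 1) := by
    have : (Finset.univ.filter
      (fun x : (Fin t → Multiplicative (ZMod p)) × (Fin s → Multiplicative (ZMod q)) =>
        x.1 ≠ 1 ∧ x.2 ≠ 1)) = (Finset.univ.erase 1) ×ˢ (Finset.univ.erase 1) := by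
      ext x; simp
    rw [this, Finset.card_product, Finset.card_erase_of_mem (Finset.mem_univ _),
      Finset.card_erase_of_mem (Finset.mem_univ _), Finset.card_univ, Finset.card_univ, hcp, hcq]
  have hl' : (p ^ t - 1) * (q ^ s - 1) = (p ^ t * q ^ s - p ^ t - q ^ s) + 1 := by
    generalize p ^ t = a at *
    generalize q ^ s = b at *
    zify [show 1 ≤ a by omega, show 1 ≤ b by omega, show a ≤ a * b by omega,
      show b ≤ a * b - a by omega]
    ring
  rw [hl'] at hl
  have key := charpoly_aux (fun x : (Fin t → Multiplicative (ZMod p)) ×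
    (Fin s → Multiplicative (ZMod q)) => x.1 ≠ 1 ∧ x.2 ≠ 1) ?_ (p ^ t + q ^ s - 1)
    (p ^ t * q ^ s - p ^ t - q ^ s) ?_ hl
  · rw [key]
    have e1 : ((p ^ t + q ^ s - 1 : ℕ) : ℝ) = (p : ℝ) ^ t + (q : ℝ) ^ s - 1 := by
      rw [Nat.cast_sub (by omega)]; push_cast; ring
    have e2 : ((p ^ t * q ^ s - p ^ t - q ^ s : ℕ) : ℝ)
        = (p : ℝ) ^ t * (q : ℝ) ^ s - (p : ℝ) ^ t - (q : ℝ) ^ s := by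
      rw [Nat.cast_sub (by omega), Nat.cast_sub (by omega)]; push_cast; ring
    rw [e1, e2]
    congr 5
    ring_nf
  · intro x y
    change (x ≠ y ∧ _) ↔ _
    rw [hord, hord]
    refine and_congr_right fun _ => ?_
    by_cases h1 : x.1 = 1 <;> by_cases h2 : x.2 = 1 <;> by_cases h3 : y.1 = 1 <;>
      by_cases h4 : y.2 = 1 <;>
      simp [h1, h2, h3, h4, hp, hq, hcop, hcop', hnp, hn1, hcop.gcd_eq_one, hcop'.gcd_eq_one,
        hp.ne_one, hq.ne_one]
  · have := Finset.card_filter_add_card_filter_not (s := (Finset.univ :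
      Finset ((Fin t → Multiplicative (ZMod p)) × (Fin s → Multiplicative (ZMod q)))))
      (fun x => x.1 ≠ 1 ∧ x.2 ≠ 1)
    rw [hl, Finset.card_univ, Fintype.card_prod, hcp, hcq] at this
    omega
end
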